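/- Let M > 0, f ∈ C⁴([−M,M]), a ∈ C³([−M,M]), and suppose the uniform strict hyperbolicity condition inf_{|u|≤M} f'(u) > sup_{|u|≤M} a(u) holds. Set h := f' − a (so h > 0 on [−M,M]). Then there exists a constant C > 0, depending only on f, a and M, such that for all u₋, u₊ ∈ [−M,M], writing [u] = u₊ − u₋: |(s(u₋,u₊) − a(u₊))/(s(u₋,u₊) − a(u₋)) − ( 1 − (a'(u₊)/h(u₊))[u] + ((h(u₊)a''(u₊) − a'(u₊)f''(u₊) + 2a'(u₊)²)/(2h(u₊)²))[u]² )| ≤ C |[u]|³. -/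

import Mathlib

open Real Set

/-- The shock-speed (divided-difference) function
`s(u₋,u₊) = (f(u₊) - f(u₋))/(u₊ - u₋)`, extended by `s(u,u) = f'(u)`. -/
noncomputable def divDiff (f : ℝ → ℝ) (p : ℝ × ℝ) : ℝ :=
  if p.1 = p.2 then deriv f p.1 else (f p.2 - f p.1) / (p.2 - p.1)

/-- The amplification factor along the Rankine–Hugoniot curve:
`r(u₋,u₊) = ((s - a(u₊))/(s - a(u₋))) · exp(A(u₋) - A(u₊))`. -/
noncomputable def rFun (f a A : ℝ → ℝ) (p : ℝ × ℝ) : ℝ :=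
  ((divDiff f p - a p.2) / (divDiff f p - a p.1)) * Real.exp (A p.1 - A p.2)

lemma step_bound (M K : ℝ) (n : ℕ) (g g' : ℝ → ℝ) (p : ℝ) (hp : p ∈ Icc (-M) M)
    (hK : 0 ≤ K)
    (hg : ∀ t, HasDerivAt g (g' t) t)
    (hb : ∀ t ∈ Icc (-M) M, |g' t| ≤ K * |t - p| ^ n) (h0 : g p = 0) :
    ∀ t ∈ Icc (-M) M, |g t| ≤ K * |t - p| ^ (n + 1) := by
  intro t ht
  have hsub : uIcc p t ⊆ Icc (-M) M := uIcc_subset_Icc hp ht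
  have := (convex_uIcc p t).norm_image_sub_le_of_norm_hasDerivWithin_le
    (f := g) (f' := g') (C := K * |t - p| ^ n) (x := p) (y := t)
    (fun x _ => (hg x).hasDerivWithinAt) (fun x hx => by
      have h1 := hb x (hsub hx)
      have h2 : |x - p| ≤ |t - p| := abs_sub_left_of_mem_uIcc hx
      rw [Real.norm_eq_abs]
      refine h1.trans ?_
      gcongr) left_mem_uIcc right_mem_uIcc
  rw [h0, sub_zero, Real.norm_eq_abs, Real.norm_eq_abs] at this
  rw [pow_succ, ← mul_assoc]
  exact this

lemma taylor_bound (M : ℝ) (g : ℝ → ℝ) (hg : ContDiff ℝ 3 g) :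
    ∃ K : ℝ, 0 ≤ K ∧ ∀ p ∈ Icc (-M) M, ∀ t ∈ Icc (-M) M,
      |g t - g p - deriv g p * (t - p) - deriv (deriv g) p / 2 * (t - p) ^ 2|
        ≤ K * |t - p| ^ 3 := by
  have hg1 : ContDiff ℝ 2 (deriv g) := by
    have : ContDiff ℝ (2 + 1) g := by norm_num; exact hg
    exact (contDiff_succ_iff_deriv.1 this).2.2
  have hg2 : ContDiff ℝ 1 (deriv (deriv g)) := by
    have : ContDiff ℝ (1 + 1) (deriv g) := by norm_num; exact hg1
    exact (contDiff_succ_iff_deriv.1 this).2.2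
  have hg3 : Continuous (deriv (deriv (deriv g))) := hg2.continuous_deriv (by norm_num)
  have d0 : ∀ t, HasDerivAt g (deriv g t) t := fun t =>
    (hg.differentiable (by norm_num) t).hasDerivAt
  have d1 : ∀ t, HasDerivAt (deriv g) (deriv (deriv g) t) t := fun t =>
    (hg1.differentiable (by norm_num) t).hasDerivAt
  have d2 : ∀ t, HasDerivAt (deriv (deriv g)) (deriv (deriv (deriv g)) t) t := fun t =>
    (hg2.differentiable (by norm_num) t).hasDerivAt
  obtain ⟨K, hK⟩ := (isCompact_Icc (a := -M) (b := M)).exists_bound_of_continuousOn hg3.continuousOn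
  refine ⟨max K 0, le_max_right _ _, fun p hp => ?_⟩
  have e2 := step_bound M (max K 0) 0 (fun t => deriv (deriv g) t - deriv (deriv g) p)
    (fun t => deriv (deriv (deriv g)) t) p hp (le_max_right _ _)
    (fun t => (d2 t).sub_const _)
    (fun t ht => by simpa using Or.inl (hK t ht)) (by simp)
  have e1 := step_bound M (max K 0) 1
    (fun t => deriv g t - deriv g p - deriv (deriv g) p * (t - p))
    (fun t => deriv (deriv g) t - deriv (deriv g) p) p hp (le_max_right _ _)
    (fun t => by
      have := ((d1 t).sub_const (deriv g p)).sub
        (((hasDerivAt_id t).sub_const p).const_mul (deriv (deriv g) p))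
      refine this.congr_deriv ?_
      simp)
    e2 (by simp)
  exact step_bound M (max K 0) 2
    (fun t => g t - g p - deriv g p * (t - p) - deriv (deriv g) p / 2 * (t - p) ^ 2)
    (fun t => deriv g t - deriv g p - deriv (deriv g) p * (t - p)) p hp (le_max_right _ _)
    (fun t => by
      have := (((d0 t).sub_const (g p)).sub
        (((hasDerivAt_id t).sub_const p).const_mul (deriv g p))).sub
        ((((hasDerivAt_id t).sub_const p).pow 2).const_mul (deriv (deriv g) p / 2))
      refine this.congr_deriv ?_
      simp
      ring)
    e1 (by simp)

/-- Second-order Taylor expansion of the quotient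
`(s - a(u₊))/(s - a(u₋))` at `u₊`, with `h = f' - a`:
`= 1 - (a'₊/h₊)[u] + ((h₊ a''₊ - a'₊ f''₊ + 2 a'₊²)/(2 h₊²))[u]² + O([u]³)`. -/
theorem shock_quotient_taylor (M : ℝ) (hM : 0 < M) (f a : ℝ → ℝ)
    (hf : ContDiff ℝ 4 f) (ha : ContDiff ℝ 3 a)
    (hUSH : sSup (a '' Icc (-M) M) < sInf (deriv f '' Icc (-M) M)) :
    ∃ C : ℝ, 0 < C ∧ ∀ um up : ℝ, um ∈ Icc (-M) M → up ∈ Icc (-M) M →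
      |(divDiff f (um, up) - a up) / (divDiff f (um, up) - a um) -
          (1 - deriv a up / (deriv f up - a up) * (up - um)
            + ((deriv f up - a up) * iteratedDeriv 2 a up
                - deriv a up * iteratedDeriv 2 f up
                + 2 * (deriv a up) ^ 2) / (2 * (deriv f up - a up) ^ 2)
              * (up - um) ^ 2)| ≤
        C * |up - um| ^ 3 := by
  have hf3 : ContDiff ℝ 3 f := hf.of_le (by norm_num)
  have cf1 : Continuous (deriv f) := hf.continuous_deriv (by norm_num)
  have ca1 : Continuous (deriv a) := ha.continuous_deriv (by norm_num)
  have ca2 : Continuous (iteratedDeriv 2 a) := ha.continuous_iteratedDeriv 2 (by norm_num)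
  have cf2 : Continuous (iteratedDeriv 2 f) := hf.continuous_iteratedDeriv 2 (by norm_num)
  have ia : iteratedDeriv 2 a = deriv (deriv a) := by
    rw [iteratedDeriv_succ, iteratedDeriv_one]
  have jf : iteratedDeriv 2 f = deriv (deriv f) := by
    rw [iteratedDeriv_succ, iteratedDeriv_one]
  obtain ⟨Ka, hKa0, hKa⟩ := taylor_bound M a ha
  obtain ⟨Kf, hKf0, hKf⟩ := taylor_bound M f hf3
  rw [← ia] at hKa
  rw [← jf] at hKf
  have hcpt : IsCompact (Icc (-M) M) := isCompact_Icc
  set c := sInf (deriv f '' Icc (-M) M) - sSup (a '' Icc (-M) M) with hc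
  have hc0 : 0 < c := by linarith
  have hlow : ∀ x ∈ Icc (-M) M, ∀ y ∈ Icc (-M) M, c ≤ deriv f x - a y := by
    intro x hx y hy
    have h1 := csInf_le (hcpt.image cf1).bddBelow (mem_image_of_mem (deriv f) hx)
    have h2 := le_csSup (hcpt.image ha.continuous).bddAbove (mem_image_of_mem a hy)
    linarith
  have hh : ∀ x ∈ Icc (-M) M, deriv f x - a x ≠ 0 := fun x hx =>
    (hc0.trans_le (hlow x hx x hx)).ne'
  have ch : Continuous (fun x => deriv f x - a x) := cf1.sub ha.continuous
  obtain ⟨B1, hB1⟩ := hcpt.exists_bound_of_continuousOn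
    (f := fun x => deriv a x / (deriv f x - a x)) (ca1.continuousOn.div ch.continuousOn hh)
  obtain ⟨B2, hB2⟩ := hcpt.exists_bound_of_continuousOn
    (f := fun x => ((deriv f x - a x) * iteratedDeriv 2 a x
                - deriv a x * iteratedDeriv 2 f x
                + 2 * (deriv a x) ^ 2) / (2 * (deriv f x - a x) ^ 2))
    (ContinuousOn.div (by have := ha.continuous; fun_prop)
      (by have := ha.continuous; fun_prop)
      (fun x hx => mul_ne_zero two_ne_zero (pow_ne_zero _ (hh x hx))))
  obtain ⟨B3, hB3⟩ := hcpt.exists_bound_of_continuousOn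
    (f := fun x => deriv a x - iteratedDeriv 2 f x / 2) (by fun_prop)
  obtain ⟨B4, hB4⟩ := hcpt.exists_bound_of_continuousOn
    (f := fun x => iteratedDeriv 2 a x / 2) (by fun_prop)
  have m0 : (0:ℝ) ∈ Icc (-M) M := ⟨by linarith, hM.le⟩
  have B10 := (norm_nonneg _).trans (hB1 0 m0)
  have B20 := (norm_nonneg _).trans (hB2 0 m0)
  have B30 := (norm_nonneg _).trans (hB3 0 m0)
  have B40 := (norm_nonneg _).trans (hB4 0 m0)
  simp only [Real.norm_eq_abs] at hB1 hB2 hB3 hB4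
  set C0 := Ka + B2 * B3 + (B1 + B2 * (2 * M)) * (Kf + B4 + Ka * (2 * M)) with hC0
  have hC00 : 0 ≤ C0 := by positivity
  refine ⟨(C0 + 1) / c, by positivity, fun um up hum hup => ?_⟩
  have hup0 := hh up hup
  by_cases hne : um = up
  · subst hne
    simp [divDiff, hup0]
  have hδ : up - um ≠ 0 := sub_ne_zero.2 (Ne.symm hne)
  -- lower bound on the denominator
  have hD : c ≤ divDiff f (um, up) - a um := by
    have hs : ∃ ξ ∈ Icc (-M) M, divDiff f (um, up) = deriv f ξ := by
      have hd : Differentiable ℝ f := hf.differentiable (by norm_num)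
      rcases lt_or_gt_of_ne hne with hlt | hlt
      · obtain ⟨ξ, hξ, he⟩ := exists_deriv_eq_slope f hlt hd.continuous.continuousOn
          hd.differentiableOn
        exact ⟨ξ, ⟨hum.1.trans hξ.1.le, hξ.2.le.trans hup.2⟩, by simp [divDiff, hne, he]⟩
      · obtain ⟨ξ, hξ, he⟩ := exists_deriv_eq_slope f hlt hd.continuous.continuousOn
          hd.differentiableOn
        refine ⟨ξ, ⟨hup.1.trans hξ.1.le, hξ.2.le.trans hum.2⟩, ?_⟩
        simp only [divDiff, hne, if_false, he]
        rw [← neg_sub (f um), ← neg_sub um, neg_div_neg_eq]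
    obtain ⟨ξ, hξ, he⟩ := hs
    rw [he]
    exact hlow ξ hξ um hum
  have tA := hKa up hup um hum
  have tF := hKf up hup um hum
  have b1 := hB1 up hup
  have b2 := hB2 up hup
  have b3 := hB3 up hup
  have b4 := hB4 up hup
  have hsv : divDiff f (um, up) = (f up - f um) / (up - um) := by simp [divDiff, hne]
  set s := divDiff f (um, up) with hs
  have hsm : s * (up - um) = f up - f um := by rw [hsv]; field_simp
  rw [abs_sub_comm um up] at tA tF
  have hδM : |up - um| ≤ 2 * M := by
    rw [abs_le]; constructor <;> linarith [hum.1, hum.2, hup.1, hup.2]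
  set h := deriv f up - a up with hhdef
  set δ := up - um with hδdef
  have hum' : um - up = -δ := by rw [hδdef]; ring
  rw [hum'] at tA tF
  set a1 := deriv a up
  set a2 := iteratedDeriv 2 a up
  set f2 := iteratedDeriv 2 f up
  set E2 := a um - a up - a1 * (-δ) - a2 / 2 * (-δ) ^ 2 with hE2
  set R := f um - f up - deriv f up * (-δ) - f2 / 2 * (-δ) ^ 2 with hR
  set Q := (h * a2 - a1 * f2 + 2 * a1 ^ 2) / (2 * h ^ 2) with hQ
  set q := a1 / h with hq
  obtain ⟨E1, hE1⟩ : ∃ E1, E1 = s - deriv f up + f2 / 2 * δ := ⟨_, rfl⟩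
  have hE1R : E1 * δ = -R := by
    rw [hE1, hR]
    linear_combination hsm
  have δpos : 0 < |δ| := abs_pos.2 hδ
  have bE1 : |E1| ≤ Kf * |δ| ^ 2 := by
    have : |E1| * |δ| ≤ (Kf * |δ| ^ 2) * |δ| := by
      rw [← abs_mul, hE1R, abs_neg]; linarith
    exact le_of_mul_le_mul_right this δpos
  obtain ⟨E3, hE3⟩ : ∃ E3, E3 = E1 - a2 / 2 * δ ^ 2 - E2 := ⟨_, rfl⟩
  have bE3 : |E3| ≤ (Kf + B4 + Ka * (2 * M)) * |δ| ^ 2 := by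
    have e1 : |a2 / 2 * δ ^ 2| ≤ B4 * |δ| ^ 2 := by
      rw [abs_mul, abs_pow]; gcongr
    have e2 : |E2| ≤ Ka * (2 * M) * |δ| ^ 2 := by
      refine tA.trans ?_
      have : Ka * |δ| ^ 3 = Ka * |δ| * |δ| ^ 2 := by ring
      rw [this]; gcongr
    have e3 := abs_sub (E1 - a2 / 2 * δ ^ 2) E2
    have e4 := abs_sub E1 (a2 / 2 * δ ^ 2)
    rw [hE3]; linarith
  have bP : |-q * δ + Q * δ ^ 2| ≤ (B1 + B2 * (2 * M)) * |δ| := by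
    have e1 : |-q * δ| ≤ B1 * |δ| := by
      rw [abs_mul, abs_neg]; gcongr
    have e2 : |Q * δ ^ 2| ≤ B2 * (2 * M) * |δ| := by
      rw [abs_mul, abs_pow, pow_two, ← mul_assoc]; gcongr
    have := abs_add_le (-q * δ) (Q * δ ^ 2)
    linarith
  have bQ : |Q * (a1 - f2 / 2) * δ ^ 3| ≤ B2 * B3 * |δ| ^ 3 := by
    rw [abs_mul, abs_mul, abs_pow]; gcongr
  have bPE : |(-q * δ + Q * δ ^ 2) * E3| ≤
      (B1 + B2 * (2 * M)) * (Kf + B4 + Ka * (2 * M)) * |δ| ^ 3 := by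
    rw [abs_mul]
    calc _ ≤ ((B1 + B2 * (2 * M)) * |δ|) * ((Kf + B4 + Ka * (2 * M)) * |δ| ^ 2) := by gcongr
      _ = _ := by ring
  have hDpos : 0 < s - a um := hc0.trans_le hD
  have hDe : s - a um = h + (a1 - f2 / 2) * δ + E3 := by
    rw [hE3, hE1, hE2, hhdef]; ring
  have hx : a um - a up = -a1 * δ + a2 / 2 * δ ^ 2 + E2 := by rw [hE2]; ring
  have hqh : q * h = a1 := by rw [hq]; field_simp
  have hQh : Q * h = a2 / 2 + q * (a1 - f2 / 2) := by rw [hQ, hq]; field_simp; ring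
  have key : (s - a up) / (s - a um) - (1 - q * δ + Q * δ ^ 2) =
      (E2 - Q * (a1 - f2 / 2) * δ ^ 3 - (-q * δ + Q * δ ^ 2) * E3) / (s - a um) := by
    rw [eq_div_iff hDpos.ne', sub_mul, div_mul_cancel₀ _ hDpos.ne']
    have : s - a up = (s - a um) + (a um - a up) := by ring
    rw [this, hx, hDe]
    linear_combination δ * hqh - δ ^ 2 * hQh
  rw [key, abs_div, abs_of_pos hDpos, div_mul_eq_mul_div (C0 + 1) c]
  apply div_le_div₀ (by positivity) _ hc0 hD
  have e1 := abs_sub (E2 - Q * (a1 - f2 / 2) * δ ^ 3) ((-q * δ + Q * δ ^ 2) * E3)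
  have e2 := abs_sub E2 (Q * (a1 - f2 / 2) * δ ^ 3)
  have : 0 ≤ |δ| ^ 3 := by positivity
  rw [hC0]
  linarith
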